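/- arXiv:2602.09073 — 4 statements merged into one kernel-verified Lean document; each statement's English description precedes it below -/
import Mathlib

section
/- Let n ≥ 3 be an odd integer with 3 ∣ n. Among the subsets of Dic_{4n} of the form A = {a^i, a^j, a^k} with 0 ≤ i < j < k ≤ 2n−1 (i.e., three-element subsets of the cyclic subgroup generated by a): the number of MSTD such subsets is 0, the number of MDTS such subsets is 4n(n²−3n+3)/3, and the number of balanced such subsets is 2n(3n−5)/3. -/
open Finset Pointwise

/-- A finset of a group is MSTD if its sumset `A * A` is larger than its
difference set `A / A = {a₁ * a₂⁻¹}`. -/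
def IsMSTD {G : Type*} [Group G] [DecidableEq G] (A : Finset G) : Prop :=
  (A / A).card < (A * A).card

/-- A finset of a group is MDTS if its sumset is smaller than its difference set. -/
def IsMDTS {G : Type*} [Group G] [DecidableEq G] (A : Finset G) : Prop :=
  (A * A).card < (A / A).card

/-- A finset of a group is balanced if its sumset and difference set have equal size. -/
def IsBalanced {G : Type*} [Group G] [DecidableEq G] (A : Finset G) : Prop :=
  (A * A).card = (A / A).card

/-- Subsets of the form `{a^i, a^j, a^k}` with `0 ≤ i < j < k ≤ 2n-1`. -/
def IsTypeA (n : ℕ) (A : Finset (QuaternionGroup n)) : Prop :=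
  ∃ i j k : ℕ, i < j ∧ j < k ∧ k ≤ 2 * n - 1 ∧
    A = {QuaternionGroup.a (i : ZMod (2 * n)), QuaternionGroup.a (j : ZMod (2 * n)),
         QuaternionGroup.a (k : ZMod (2 * n))}

section CommRing

variable {R : Type*} [CommRing R] [DecidableEq R]

/-- A three-term progression is a translate of its own negation, so its sumset and
difference set have the same size. -/
theorem card_add_eq_card_sub_of_progression (c d : R) :
    (({c - d, c, c + d} : Finset R) + {c - d, c, c + d}).card =
      (({c - d, c, c + d} : Finset R) - {c - d, c, c + d}).card := by
  have hneg : -({c - d, c, c + d} : Finset R) =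
      -(c + c) +ᵥ ({c - d, c, c + d} : Finset R) := by
    ext x
    simp only [neg_insert, neg_singleton, vadd_finset_insert, vadd_finset_singleton, vadd_eq_add,
      mem_insert, mem_singleton]
    grind
  rw [sub_eq_add_neg ({c - d, c, c + d} : Finset R), hneg, add_vadd_comm, card_vadd_finset]

theorem card_add_lt_card_sub_of_two_torsion
    (huniq : ∀ u v : R, u + u = 0 → v + v = 0 → u ≠ 0 → v ≠ 0 → u = v)
    {x y z : R} (hxy : x ≠ y) (hxz : x ≠ z) (hyz : y ≠ z) (h : x + x = y + y)
    (hz : x + y ≠ z + z) :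
    (({x, y, z} : Finset R) + {x, y, z}).card < (({x, y, z} : Finset R) - {x, y, z}).card := by
  have hxz2 : x + x ≠ z + z := fun e => hyz <| by
    have := huniq (y - x) (z - x) (by grind) (by grind) (by grind) (by grind)
    grind
  have hsum : ({x, y, z} : Finset R) + {x, y, z} ⊆ {x + x, z + z, x + y, x + z, y + z} := by
    intro t
    simp only [mem_add, mem_insert, mem_singleton, exists_eq_or_imp, exists_eq_left]
    grind
  have hdiff : ({0, y - x, z - x, x - z, z - y, y - z} : Finset R) ⊆
      ({x, y, z} : Finset R) - {x, y, z} := by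
    intro t
    simp only [mem_sub, mem_insert, mem_singleton, exists_eq_or_imp, exists_eq_left]
    grind
  have h6 : ({0, y - x, z - x, x - z, z - y, y - z} : Finset R).card = 6 := by
    repeat rw [card_insert_of_notMem (by
      simp only [mem_insert, mem_singleton]
      grind)]
    simp
  have := card_le_card hsum
  have := card_le_card hdiff
  have := card_le_five (a := x + x) (b := z + z) (c := x + y) (d := x + z) (e := y + z)
  omega

theorem card_add_lt_card_sub_of_not_progression
    (huniq : ∀ u v : R, u + u = 0 → v + v = 0 → u ≠ 0 → v ≠ 0 → u = v)
    {x y z : R} (hxy : x ≠ y) (hxz : x ≠ z) (hyz : y ≠ z)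
    (hx : y + z ≠ x + x) (hy : x + z ≠ y + y) (hz : x + y ≠ z + z) :
    (({x, y, z} : Finset R) + {x, y, z}).card < (({x, y, z} : Finset R) - {x, y, z}).card := by
  by_cases h1 : x + x = y + y
  · exact card_add_lt_card_sub_of_two_torsion huniq hxy hxz hyz h1 hz
  by_cases h2 : x + x = z + z
  · rw [show ({x, y, z} : Finset R) = {x, z, y} by ext; simp; tauto]
    exact card_add_lt_card_sub_of_two_torsion huniq hxz hxy hyz.symm h2 hy
  by_cases h3 : y + y = z + z
  · rw [show ({x, y, z} : Finset R) = {y, z, x} by ext; simp; tauto]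
    exact card_add_lt_card_sub_of_two_torsion huniq hyz hxy.symm hxz.symm h3 hx
  have hsum : ({x, y, z} : Finset R) + {x, y, z} ⊆
      {x + x, y + y, z + z, x + y, x + z, y + z} := by
    intro t
    simp only [mem_add, mem_insert, mem_singleton, exists_eq_or_imp, exists_eq_left]
    grind
  have hdiff : ({0, y - x, x - y, z - x, x - z, z - y, y - z} : Finset R) ⊆
      ({x, y, z} : Finset R) - {x, y, z} := by
    intro t
    simp only [mem_sub, mem_insert, mem_singleton, exists_eq_or_imp, exists_eq_left]
    grind
  have h7 : ({0, y - x, x - y, z - x, x - z, z - y, y - z} : Finset R).card = 7 := by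
    repeat rw [card_insert_of_notMem (by
      simp only [mem_insert, mem_singleton]
      grind)]
    simp
  have := card_le_card hsum
  have := card_le_card hdiff
  have := card_le_six (a := x + x) (b := y + y) (c := z + z) (d := x + y) (e := x + z) (f := y + z)
  omega

/-- Three-element progressions. -/
def IsProgression (B : Finset R) : Prop :=
  ∃ c d : R, d + d ≠ 0 ∧ B = {c - d, c, c + d}

theorem card_add_lt_card_sub_of_not_isProgression
    (huniq : ∀ u v : R, u + u = 0 → v + v = 0 → u ≠ 0 → v ≠ 0 → u = v)
    {B : Finset R} (hB : B.card = 3) (h : ¬ IsProgression B) : (B + B).card < (B - B).card := by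
  obtain ⟨x, y, z, hxy, hxz, hyz, rfl⟩ := card_eq_three.1 hB
  refine card_add_lt_card_sub_of_not_progression huniq hxy hxz hyz
    (fun e => h ⟨x, y - x, by grind, ?_⟩) (fun e => h ⟨y, x - y, by grind, ?_⟩)
    (fun e => h ⟨z, x - z, by grind, ?_⟩) <;>
  · ext t
    simp only [mem_insert, mem_singleton]
    grind

theorem IsProgression.card_eq_three {B : Finset R} (h : IsProgression B) : B.card = 3 := by
  obtain ⟨c, d, hd, rfl⟩ := h
  rw [Finset.card_eq_three]
  exact ⟨_, _, _, by grind, by grind, by grind, rfl⟩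

end CommRing

theorem ZMod.eq_natCast_of_add_self_eq_zero {n : ℕ} (hn : 0 < n) {u : ZMod (2 * n)}
    (h : u + u = 0) (h0 : u ≠ 0) : u = (n : ZMod (2 * n)) := by
  have : NeZero (2 * n) := ⟨by omega⟩
  rw [← ZMod.natCast_zmod_val u, ← Nat.cast_add, ZMod.natCast_eq_zero_iff] at h
  have hlt := ZMod.val_lt u
  have hpos : 0 < u.val := Nat.pos_of_ne_zero fun e => h0 ((ZMod.val_eq_zero u).1 e)
  obtain ⟨k, hk⟩ := h
  have : k = 1 := by
    have h1 : k < 2 := by by_contra! hc; nlinarith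
    have h2 : k ≠ 0 := by rintro rfl; omega
    omega
  subst this
  rw [← ZMod.natCast_zmod_val u]
  congr 1
  omega

/-- The progression of residues modulo `m` with centre `c` and common difference `d`. -/
def progression (m c d : ℕ) : Finset (ZMod m) := {(c : ZMod m) - d, (c : ZMod m), (c : ZMod m) + d}

/-- Centres and differences representing each progression modulo `6 * q` once. -/
def progressionIndex (q : ℕ) : Finset (ℕ × ℕ) :=
  (range (6 * q) ×ˢ (Ico 1 (3 * q)).erase (2 * q)) ∪ (range (2 * q) ×ˢ {2 * q})

theorem mem_progressionIndex {q c d : ℕ} (hq : 0 < q) : (c, d) ∈ progressionIndex q ↔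
    c < 6 * q ∧ 0 < d ∧ d < 3 * q ∧ (d = 2 * q → c < 2 * q) := by
  simp only [progressionIndex, mem_union, mem_product, mem_range, mem_erase, mem_Ico,
    mem_singleton]
  omega

theorem card_progressionIndex {q : ℕ} (hq : 0 < q) :
    (progressionIndex q).card = 6 * q * (3 * q - 2) + 2 * q := by
  rw [progressionIndex, card_union_of_disjoint, card_product, card_product, card_erase_of_mem]
  · simp only [card_range, Nat.card_Ico, card_singleton, mul_one]
    congr 2
  · simp only [mem_Ico]; omega
  · rw [disjoint_left]
    rintro ⟨c, d⟩
    simp only [mem_product, mem_erase, mem_singleton]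
    tauto

theorem ZMod.exists_eq_mul_of_intCast_eq_zero {q : ℕ} {a : ℤ}
    (h : (a : ZMod (6 * q)) = 0) : ∃ k : ℤ, a = 6 * (q * k) := by
  rw [ZMod.intCast_zmod_eq_zero_iff_dvd] at h
  obtain ⟨k, hk⟩ := h
  exact ⟨k, by rw [hk]; push_cast; ring⟩

theorem eq_two_mul_of_three_mul_eq_zero {q d : ℕ} (h0 : 0 < d) (h1 : d < 3 * q)
    (h : (d : ZMod (6 * q)) + d + d = 0) : d = 2 * q := by
  obtain ⟨k, hk⟩ := ZMod.exists_eq_mul_of_intCast_eq_zero (q := q) (a := 3 * d)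
    (by push_cast; linear_combination h)
  have h2 : 0 < k := by by_contra! hc; nlinarith
  have h3 : k < 2 := by by_contra! hc; nlinarith
  obtain rfl : k = 1 := by omega
  omega

theorem natCast_injOn {q c c' : ℕ} (h : c < 6 * q) (h' : c' < 6 * q)
    (e : (c : ZMod (6 * q)) = c') : c = c' := by
  rw [ZMod.natCast_eq_natCast_iff'] at e
  rwa [Nat.mod_eq_of_lt h, Nat.mod_eq_of_lt h'] at e

theorem natCast_add_ne_zero {q d d' : ℕ} (h0 : 0 < d) (h : d < 3 * q) (h' : d' < 3 * q) :
    (d : ZMod (6 * q)) + d' ≠ 0 := by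
  intro e
  rw [← Nat.cast_add, ZMod.natCast_eq_zero_iff] at e
  have := Nat.le_of_dvd (by omega) e
  omega

theorem progression_injOn {q : ℕ} (hq : 0 < q) :
    Set.InjOn (fun p : ℕ × ℕ => progression (6 * q) p.1 p.2) (progressionIndex q) := by
  rintro ⟨c, d⟩ h ⟨c', d'⟩ h' e
  rw [mem_coe, mem_progressionIndex hq] at h h'
  obtain ⟨hc, hd0, hd, hcd⟩ := h
  obtain ⟨hc', hd0', hd', hcd'⟩ := h'
  have hdd := natCast_add_ne_zero hd0 hd hd
  have hdd' := natCast_add_ne_zero hd0' hd' hd'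
  have hdx := natCast_add_ne_zero hd0 hd hd'
  have hinj := natCast_injOn (q := q) (c := d) (c' := d') (by omega) (by omega)
  have hcinj := natCast_injOn hc hc'
  have h3 := eq_two_mul_of_three_mul_eq_zero hd0 hd
  have h3' := eq_two_mul_of_three_mul_eq_zero hd0' hd'
  have e1 : ∀ t, t ∈ progression (6 * q) c d ↔ t ∈ progression (6 * q) c' d' :=
    fun t => by rw [show progression (6 * q) c d = progression (6 * q) c' d' from e]
  simp only [progression, mem_insert, mem_singleton] at e1
  have e2 := (e1 ((c' : ZMod (6 * q)) - d')).2 (Or.inl rfl)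
  have e3 := (e1 (c' : ZMod (6 * q))).2 (Or.inr (Or.inl rfl))
  have e4 := (e1 ((c' : ZMod (6 * q)) + d')).2 (Or.inr (Or.inr rfl))
  clear e1 e
  have key : (c : ZMod (6 * q)) = c' ∧ (d : ZMod (6 * q)) = d' ∨
      (d : ZMod (6 * q)) + d + d = 0 ∧ (d' : ZMod (6 * q)) + d' + d' = 0 := by
    generalize (c : ZMod (6 * q)) = C at *
    generalize (d : ZMod (6 * q)) = D at *
    generalize (c' : ZMod (6 * q)) = C' at *
    generalize (d' : ZMod (6 * q)) = D' at *
    clear hinj hcinj h3 h3' hcd hcd'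
    grind
  rcases key with ⟨k1, k2⟩ | ⟨k1, k2⟩
  · rw [hcinj k1, hinj k2]
  · obtain rfl := h3 k1
    obtain rfl := h3' k2
    have hcq := hcd rfl
    have hcq' := hcd' rfl
    congr 1
    have : ((3 * c : ℕ) : ZMod (6 * q)) = (3 * c' : ℕ) := by
      push_cast at k1 e3 ⊢
      rcases e3 with e | e | e <;> grind
    have := natCast_injOn (by omega) (by omega) this
    omega

theorem isProgression_progression {q c d : ℕ} (h0 : 0 < d) (h : d < 3 * q) :
    IsProgression (progression (6 * q) c d) :=
  ⟨c, d, natCast_add_ne_zero h0 h h, rfl⟩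

theorem IsProgression.exists_mem_progressionIndex {q : ℕ} (hq : 0 < q)
    {B : Finset (ZMod (6 * q))} (hB : IsProgression B) :
    ∃ p ∈ progressionIndex q, progression (6 * q) p.1 p.2 = B := by
  have : NeZero (6 * q) := ⟨by omega⟩
  obtain ⟨C, D, hD, rfl⟩ := hB
  obtain ⟨d, hd0, hd, hdD⟩ : ∃ d : ℕ, 0 < d ∧ d < 3 * q ∧
      ((d : ZMod (6 * q)) = D ∨ (d : ZMod (6 * q)) = -D) := by
    have hlt := ZMod.val_lt D
    have hval := ZMod.natCast_zmod_val D
    have h0 : D.val ≠ 0 := fun e => hD (by rw [← hval, e]; simp)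
    have h3 : D.val ≠ 3 * q := fun e => hD (by
      rw [← hval, e, ← Nat.cast_add, ZMod.natCast_eq_zero_iff]
      exact ⟨1, by ring⟩)
    by_cases h : D.val < 3 * q
    · exact ⟨D.val, by omega, h, Or.inl hval⟩
    · refine ⟨6 * q - D.val, by omega, by omega, Or.inr ?_⟩
      rw [Nat.cast_sub hlt.le, hval, ZMod.natCast_self, zero_sub]
  have hprog : ({C - D, C, C + D} : Finset (ZMod (6 * q))) = {C - d, C, C + (d : ZMod _)} := by
    rcases hdD with h | h <;> rw [h]
    ext t
    simp only [mem_insert, mem_singleton, sub_neg_eq_add, ← sub_eq_add_neg]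
    tauto
  rw [hprog]
  have hC := ZMod.val_lt C
  have hCval := ZMod.natCast_zmod_val C
  by_cases hd2 : d = 2 * q
  · subst hd2
    refine ⟨(C.val % (2 * q), 2 * q), (mem_progressionIndex hq).2
      ⟨?_, hd0, hd, fun _ => Nat.mod_lt _ hd0⟩, ?_⟩
    · have := Nat.mod_lt C.val hd0
      omega
    · have hdm := Nat.mod_add_div C.val (2 * q)
      have hk : C.val / (2 * q) < 3 := by
        rw [Nat.div_lt_iff_lt_mul hd0]; omega
      have hcast : C = ((C.val % (2 * q) : ℕ) : ZMod (6 * q)) +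
          ((2 * q : ℕ) : ZMod (6 * q)) * ((C.val / (2 * q) : ℕ) : ZMod (6 * q)) := by
        rw [← Nat.cast_mul, ← Nat.cast_add, hdm, hCval]
      have h3 : ((2 * q : ℕ) : ZMod (6 * q)) + (2 * q : ℕ) + (2 * q : ℕ) = 0 := by
        rw [← Nat.cast_add, ← Nat.cast_add, ZMod.natCast_eq_zero_iff]
        exact ⟨1, by ring⟩
      ext t
      simp only [progression, mem_insert, mem_singleton]
      generalize ((C.val % (2 * q) : ℕ) : ZMod (6 * q)) = R at *
      generalize ((2 * q : ℕ) : ZMod (6 * q)) = D at *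
      generalize C.val / (2 * q) = k at *
      clear hprog hdD hdm hCval hC
      obtain rfl | rfl | rfl : C = R ∨ C = R + D ∨ C = R - D := by
        interval_cases k <;> push_cast at hcast
        · exact Or.inl (by linear_combination hcast)
        · exact Or.inr (Or.inl (by linear_combination hcast))
        · exact Or.inr (Or.inr (by linear_combination hcast + h3))
      all_goals grind
  · exact ⟨(C.val, d), (mem_progressionIndex hq).2 ⟨hC, hd0, hd, fun h => absurd h hd2⟩,
      by simp only [progression, hCval]⟩

theorem QuaternionGroup.a_injective (n : ℕ) :
    Function.Injective (QuaternionGroup.a : ZMod (2 * n) → QuaternionGroup n) :=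
  fun _ _ h => QuaternionGroup.a.inj h

theorem QuaternionGroup.card_image_a_mul {n : ℕ} (B : Finset (ZMod (2 * n))) :
    (B.image (QuaternionGroup.a (n := n)) * B.image QuaternionGroup.a).card = (B + B).card := by
  have : B.image (QuaternionGroup.a (n := n)) * B.image QuaternionGroup.a =
      (B + B).image QuaternionGroup.a :=
    (image_image₂_distrib fun x y => (QuaternionGroup.a_mul_a x y).symm).symm
  rw [this, card_image_of_injective _ (a_injective n)]

theorem QuaternionGroup.card_image_a_div {n : ℕ} (B : Finset (ZMod (2 * n))) :
    (B.image (QuaternionGroup.a (n := n)) / B.image QuaternionGroup.a).card = (B - B).card := by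
  have : B.image (QuaternionGroup.a (n := n)) / B.image QuaternionGroup.a =
      (B - B).image QuaternionGroup.a :=
    (image_image₂_distrib fun x y => by
      rw [eq_div_iff_mul_eq', QuaternionGroup.a_mul_a, sub_add_cancel]).symm
  rw [this, card_image_of_injective _ (a_injective n)]

theorem isTypeA_iff {n : ℕ} (hn : 0 < n) (A : Finset (QuaternionGroup n)) :
    IsTypeA n A ↔ ∃ B : Finset (ZMod (2 * n)), B.card = 3 ∧ B.image QuaternionGroup.a = A := by
  have : NeZero (2 * n) := ⟨by omega⟩
  constructor
  · rintro ⟨i, j, k, hij, hjk, hk, rfl⟩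
    have hinj : ∀ {s t : ℕ}, s < t → t < 2 * n → (s : ZMod (2 * n)) ≠ t := by
      intro s t hst ht e
      rw [ZMod.natCast_eq_natCast_iff', Nat.mod_eq_of_lt ht, Nat.mod_eq_of_lt (hst.trans ht)] at e
      omega
    exact ⟨{(i : ZMod (2 * n)), (j : ZMod (2 * n)), (k : ZMod (2 * n))},
      card_eq_three.2 ⟨_, _, _, hinj hij (by omega), hinj (hij.trans hjk) (by omega),
        hinj hjk (by omega), rfl⟩, by simp⟩
  · rintro ⟨B, hB, rfl⟩
    have hcard : (B.image ZMod.val).card = 3 := by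
      rw [card_image_of_injective _ (ZMod.val_injective _), hB]
    let f := (B.image ZMod.val).orderEmbOfFin hcard
    have hmem : ∀ i, f i < 2 * n := fun i => by
      obtain ⟨b, -, hb⟩ := mem_image.1 (orderEmbOfFin_mem (B.image ZMod.val) hcard i)
      exact hb ▸ ZMod.val_lt b
    have himg : B = (univ.image f).image (Nat.cast : ℕ → ZMod (2 * n)) := by
      rw [show univ.image f = B.image ZMod.val from image_orderEmbOfFin_univ _ _, image_image]
      ext; simp
    refine ⟨f 0, f 1, f 2, f.strictMono (by decide), f.strictMono (by decide), ?_, ?_⟩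
    · have := hmem 2; omega
    · rw [himg]
      simp [Fin.univ_succ, image_insert]

theorem ncard_isTypeA {n : ℕ} (hn : 0 < n) [NeZero (2 * n)] (P : Finset (QuaternionGroup n) → Prop)
    (Q : Finset (ZMod (2 * n)) → Prop) [DecidablePred Q]
    (hPQ : ∀ B : Finset (ZMod (2 * n)), B.card = 3 → (P (B.image QuaternionGroup.a) ↔ Q B)) :
    {A : Finset (QuaternionGroup n) | IsTypeA n A ∧ P A}.ncard =
      ((powersetCard 3 (univ : Finset (ZMod (2 * n)))).filter Q).card := by
  rw [← card_image_of_injective _ (image_injective (QuaternionGroup.a_injective n)),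
    ← Set.ncard_coe_finset]
  congr 1
  ext A
  simp only [Set.mem_ofPred_eq, isTypeA_iff hn, coe_image, Set.mem_image, mem_coe, mem_filter,
    mem_powersetCard_univ]
  constructor
  · rintro ⟨⟨B, hB, rfl⟩, h⟩
    exact ⟨B, ⟨hB, (hPQ B hB).1 h⟩, rfl⟩
  · rintro ⟨B, ⟨hB, h⟩, rfl⟩
    exact ⟨⟨B, hB, rfl⟩, (hPQ B hB).2 h⟩

open Classical in
theorem card_filter_isProgression {q : ℕ} (hq : 0 < q) [NeZero (6 * q)] :
    ((powersetCard 3 (univ : Finset (ZMod (6 * q)))).filter IsProgression).card =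
      6 * q * (3 * q - 2) + 2 * q := by
  rw [← card_progressionIndex hq, ← card_image_of_injOn (progression_injOn hq)]
  congr 1
  ext B
  simp only [mem_filter, mem_powersetCard_univ, mem_image]
  constructor
  · rintro ⟨-, h⟩
    exact h.exists_mem_progressionIndex hq
  · rintro ⟨⟨c, d⟩, hp, rfl⟩
    obtain ⟨-, h0, h, -⟩ := (mem_progressionIndex hq).1 hp
    have := isProgression_progression (c := c) h0 h
    exact ⟨this.card_eq_three, this⟩

theorem stmt_12 (n : ℕ) (hn : 3 ≤ n) (hodd : Odd n) (hdvd : 3 ∣ n) :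
    {A : Finset (QuaternionGroup n) | IsTypeA n A ∧ IsMSTD A}.ncard = 0 ∧
    {A : Finset (QuaternionGroup n) | IsTypeA n A ∧ IsMDTS A}.ncard
        = 4 * n * (n ^ 2 - 3 * n + 3) / 3 ∧
    {A : Finset (QuaternionGroup n) | IsTypeA n A ∧ IsBalanced A}.ncard
        = 2 * n * (3 * n - 5) / 3 := by
  classical
  have hn0 : 0 < n := by omega
  have : NeZero (2 * n) := ⟨by omega⟩
  have hlt : ∀ B : Finset (ZMod (2 * n)), B.card = 3 → ¬ IsProgression B →
      (B + B).card < (B - B).card := fun B hB h =>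
    card_add_lt_card_sub_of_not_isProgression (fun u v hu hv hu0 hv0 =>
      (ZMod.eq_natCast_of_add_self_eq_zero hn0 hu hu0).trans
        (ZMod.eq_natCast_of_add_self_eq_zero hn0 hv hv0).symm) hB h
  have heq : ∀ B : Finset (ZMod (2 * n)), IsProgression B → (B + B).card = (B - B).card := by
    rintro B ⟨c, d, -, rfl⟩
    convert card_add_eq_card_sub_of_progression c d
  have hcount : ((powersetCard 3 (univ : Finset (ZMod (2 * n)))).filter IsProgression).card =
      2 * n * (n - 2) + 2 * n / 3 := by
    obtain ⟨q, rfl⟩ := hdvd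
    have h6 : 2 * (3 * q) = 6 * q := by ring
    have hq : 0 < q := by omega
    have : NeZero (6 * q) := ⟨by omega⟩
    have key := card_filter_isProgression hq
    rw [show 2 * (3 * q) * (3 * q - 2) + 2 * (3 * q) / 3 = 6 * q * (3 * q - 2) + 2 * q by
      rw [h6]; omega, ← key]
    congr!
  have hstd := ncard_isTypeA hn0 IsMSTD (fun _ => False) fun B hB => by
    rw [IsMSTD, QuaternionGroup.card_image_a_mul, QuaternionGroup.card_image_a_div]
    by_cases h : IsProgression B
    · simp [heq B h]
    · simp [(hlt B hB h).le]
  have hdts := ncard_isTypeA hn0 IsMDTS (fun B => ¬ IsProgression B) fun B hB => by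
    rw [IsMDTS, QuaternionGroup.card_image_a_mul, QuaternionGroup.card_image_a_div]
    by_cases h : IsProgression B
    · simp [heq B h, h]
    · simp [hlt B hB h, h]
  have hbal := ncard_isTypeA hn0 IsBalanced IsProgression fun B hB => by
    rw [IsBalanced, QuaternionGroup.card_image_a_mul, QuaternionGroup.card_image_a_div]
    by_cases h : IsProgression B
    · simp [heq B h, h]
    · simp [(hlt B hB h).ne, h]
  have htot := card_filter_add_card_filter_not (s := powersetCard 3 (univ : Finset (ZMod (2 * n))))
    IsProgression
  rw [card_powersetCard, card_univ, ZMod.card] at htot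
  rw [hstd, hdts, hbal]
  rw [hcount] at htot ⊢
  have hchoose := Nat.descFactorial_eq_factorial_mul_choose (2 * n) 3
  rw [← htot] at hchoose
  obtain ⟨q, rfl⟩ := hdvd
  obtain ⟨r, rfl⟩ : ∃ r, q = r + 1 := ⟨q - 1, by omega⟩
  have h1 : 2 * (3 * (r + 1)) / 3 = 2 * (r + 1) := by omega
  have h2 : 3 * (r + 1) - 2 = 3 * r + 1 := by omega
  have h3 : (3 * (r + 1)) ^ 2 - 3 * (3 * (r + 1)) + 3 = 9 * r ^ 2 + 9 * r + 3 := by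
    rw [show (3 * (r + 1)) ^ 2 = 9 * r ^ 2 + 9 * r + 3 * (3 * (r + 1)) by ring,
      Nat.add_sub_cancel]
  have h4 : 3 * (3 * (r + 1)) - 5 = 9 * r + 4 := by omega
  have h5 : 2 * (3 * (r + 1)) - 1 = 6 * r + 5 := by omega
  have h6 : 2 * (3 * (r + 1)) - 2 = 6 * r + 4 := by omega
  rw [h1, h2] at hchoose ⊢
  simp only [Nat.descFactorial_succ, Nat.descFactorial_zero, Nat.sub_zero, h5, h6,
    show Nat.factorial 3 = 6 from rfl] at hchoose
  rw [h3, h4]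
  refine ⟨by simp, ?_, ?_⟩
  · symm
    apply Nat.div_eq_of_eq_mul_right (by norm_num)
    linarith
  · symm
    apply Nat.div_eq_of_eq_mul_right (by norm_num)
    ring
end

section
/- Let n ≥ 3 be an odd integer. Among the subsets of Dic_{4n} of the form B = {a^i, a^j, a^k b} with 0 ≤ i < j ≤ 2n−1 and 0 ≤ k ≤ 2n−1 (i.e., three-element subsets containing exactly two elements of the cyclic subgroup generated by a): the number of MSTD such subsets is 2n(n−1)(2n−5), the number of MDTS such subsets is 2n(n−1), and the number of balanced such subsets is 2n(5n−4). -/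
open Finset Pointwise

/-- Subsets of the form `{a^i, a^j, a^k b}` with `0 ≤ i < j ≤ 2n-1` and `0 ≤ k ≤ 2n-1`. -/
def IsTypeB (n : ℕ) (A : Finset (QuaternionGroup n)) : Prop :=
  ∃ i j k : ℕ, i < j ∧ j ≤ 2 * n - 1 ∧ k ≤ 2 * n - 1 ∧
    A = {QuaternionGroup.a (i : ZMod (2 * n)), QuaternionGroup.a (j : ZMod (2 * n)),
         QuaternionGroup.xa (k : ZMod (2 * n))}

namespace QuaternionGroup

variable {n : ℕ}

theorem natCast_add_natCast_self : (n : ZMod (2 * n)) + n = 0 := by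
  have : ((2 * n : ℕ) : ZMod (2 * n)) = 0 := ZMod.natCast_self _
  push_cast at this
  linear_combination this

theorem natCast_ne_zero (hn : 0 < n) : (n : ZMod (2 * n)) ≠ 0 := by
  rw [Ne, ZMod.natCast_eq_zero_iff]
  intro h
  have := Nat.le_of_dvd hn h
  omega

theorem add_self_ne_natCast (hodd : Odd n) (x : ZMod (2 * n)) : x + x ≠ n := by
  intro h
  have h2 := congrArg (ZMod.castHom (Dvd.intro n rfl : 2 ∣ 2 * n) (ZMod 2)) h
  rw [map_add, map_natCast, (ZMod.natCast_eq_one_iff_odd).2 hodd, CharTwo.add_self_eq_zero] at h2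
  exact zero_ne_one h2

theorem add_self_eq_zero_iff (hn : 0 < n) (x : ZMod (2 * n)) :
    x + x = 0 ↔ x = 0 ∨ x = n := by
  have : NeZero (2 * n) := ⟨by omega⟩
  constructor
  · intro h
    obtain ⟨k, hk, rfl⟩ : ∃ k : ℕ, k < 2 * n ∧ (k : ZMod (2 * n)) = x :=
      ⟨x.val, x.val_lt, ZMod.natCast_zmod_val x⟩
    rw [← Nat.cast_add, ZMod.natCast_eq_zero_iff] at h
    obtain ⟨c, hc⟩ := h
    have hc2 : c < 2 := by
      by_contra! h2
      nlinarith
    have : k = 0 ∨ k = n := by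
      interval_cases c <;> omega
    rcases this with rfl | rfl <;> simp
  · rintro (rfl | rfl)
    · simp
    · exact natCast_add_natCast_self

/-- The set consisting of `a x`, `a y` and `xa z`. -/
def triple (x y z : ZMod (2 * n)) : Finset (QuaternionGroup n) := {a x, a y, xa z}

theorem card_image_a_union_image_xa (S T : Finset (ZMod (2 * n))) :
    (S.image a ∪ T.image xa : Finset (QuaternionGroup n)).card = S.card + T.card := by
  rw [Finset.card_union_of_disjoint, card_image_of_injective, card_image_of_injective]
  · intro u v h; simpa using h
  · intro u v h; simpa using h
  · simp [Finset.disjoint_left]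

theorem a_div_a (i j : ZMod (2 * n)) : (a i / a j : QuaternionGroup n) = a (i - j) := by
  simp [div_eq_iff_eq_mul]

theorem a_div_xa (i j : ZMod (2 * n)) :
    (a i / xa j : QuaternionGroup n) = xa ((n : ZMod (2 * n)) + j - i) := by
  rw [div_eq_iff_eq_mul, xa_mul_xa]
  congr 1
  ring

theorem xa_div_a (i j : ZMod (2 * n)) : (xa i / a j : QuaternionGroup n) = xa (i - j) := by
  simp [div_eq_iff_eq_mul]

theorem xa_div_xa (i j : ZMod (2 * n)) : (xa i / xa j : QuaternionGroup n) = a (j - i) := by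
  simp [div_eq_iff_eq_mul]

theorem card_triple_mul_triple (x y z : ZMod (2 * n)) :
    (triple x y z * triple x y z).card =
      ({x + x, x + y, y + y, (n : ZMod (2 * n))} : Finset _).card +
        ({z - x, z - y, z + x, z + y} : Finset _).card := by
  rw [← card_image_a_union_image_xa]
  congr 1
  ext g
  simp only [triple, Finset.mem_mul, mem_union, mem_image, mem_insert, mem_singleton, or_and_right,
    exists_or, exists_eq_left, a_mul_a, a_mul_xa, xa_mul_a, xa_mul_xa, add_sub_cancel_right,
    add_comm y x]
  tauto

theorem card_triple_div_triple (x y z : ZMod (2 * n)) :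
    (triple x y z / triple x y z).card =
      ({0, x - y, y - x} : Finset (ZMod (2 * n))).card +
        ({z - x, z - y, n + z - x, n + z - y} : Finset (ZMod (2 * n))).card := by
  rw [← card_image_a_union_image_xa]
  congr 1
  ext g
  simp only [triple, Finset.mem_div, mem_union, mem_image, mem_insert, mem_singleton, or_and_right,
    exists_or, exists_eq_left, a_div_a, a_div_xa, xa_div_a, xa_div_xa, sub_self]
  tauto

section CommRing

variable {R : Type*} [CommRing R] [DecidableEq R] {m x y : R}

theorem card_add_self_insert (hm : m + m = 0) (hx : x + x ≠ m) (hy : y + y ≠ m) (hxy : x ≠ y)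
    (hd : (y - x) + (y - x) = 0 ↔ y - x = 0 ∨ y - x = m) :
    ({x + x, x + y, y + y, m} : Finset R).card =
      if y = x + m then (if x + x = 0 then 2 else 3) else if x + y = m then 3 else 4 := by
  simp only [Finset.card_insert_eq_ite, Finset.card_singleton, mem_insert, mem_singleton]
  split_ifs <;> grind

theorem card_sub_sub_add_add (z : R) (hxy : x ≠ y) :
    ({z - x, z - y, z + x, z + y} : Finset R).card =
      if x + y = 0 then 2 else if x + x = 0 then (if y + y = 0 then 2 else 3)
        else if y + y = 0 then 3 else 4 := by
  simp only [Finset.card_insert_eq_ite, Finset.card_singleton, mem_insert, mem_singleton]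
  split_ifs <;> grind

theorem card_zero_sub_sub (hm : m + m = 0) (h0 : m ≠ 0) (hxy : x ≠ y)
    (hd : (y - x) + (y - x) = 0 ↔ y - x = 0 ∨ y - x = m) :
    ({0, x - y, y - x} : Finset R).card = if y = x + m then 2 else 3 := by
  simp only [Finset.card_insert_eq_ite, Finset.card_singleton, mem_insert, mem_singleton]
  split_ifs <;> grind

theorem card_sub_sub_add_sub_add_sub (z : R) (hm : m + m = 0) (h0 : m ≠ 0) (hxy : x ≠ y) :
    ({z - x, z - y, m + z - x, m + z - y} : Finset R).card = if y = x + m then 2 else 4 := by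
  simp only [Finset.card_insert_eq_ite, Finset.card_singleton, mem_insert, mem_singleton]
  split_ifs <;> grind

end CommRing

theorem card_triple_div_triple_eq_ite (hodd : Odd n) {x y : ZMod (2 * n)}
    (z : ZMod (2 * n)) (hxy : x ≠ y) :
    (triple x y z / triple x y z).card = if y = x + n then 4 else 7 := by
  have h := natCast_add_natCast_self (n := n)
  have h0 := natCast_ne_zero hodd.pos
  have hd := add_self_eq_zero_iff hodd.pos (y - x)
  rw [card_triple_div_triple, card_zero_sub_sub h h0 hxy hd,
    card_sub_sub_add_sub_add_sub z h h0 hxy]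
  split_ifs <;> rfl

theorem card_triple_mul_triple_eq_ite (hodd : Odd n) {x y : ZMod (2 * n)}
    (z : ZMod (2 * n)) (hxy : x ≠ y) :
    (triple x y z * triple x y z).card = if y = x + n then
        (if x + x = 0 then 4 else 7) else if x + y = 0 then 6
        else if x + x = 0 ∨ y + y = 0 ∨ x + y = n then 7 else 8 := by
  have h := natCast_add_natCast_self (n := n)
  have h0 := natCast_ne_zero hodd.pos
  have hx := add_self_ne_natCast hodd x
  have hy := add_self_ne_natCast hodd y
  have hx0 := add_self_eq_zero_iff hodd.pos x
  have hy0 := add_self_eq_zero_iff hodd.pos y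
  have hd := add_self_eq_zero_iff hodd.pos (y - x)
  rw [card_triple_mul_triple, card_add_self_insert h hx hy hxy hd, card_sub_sub_add_add z hxy]
  generalize (n : ZMod (2 * n)) = m at *
  split_ifs <;> grind

theorem triple_eq_triple_iff {x y z x' y' z' : ZMod (2 * n)} :
    triple x y z = triple x' y' z' ↔
      ((x = x' ∧ y = y') ∨ (x = y' ∧ y = x')) ∧ z = z' := by
  constructor
  · intro h
    simp only [triple, Finset.ext_iff, mem_insert, mem_singleton] at h
    have h1 := h (a x)
    have h2 := h (a y)
    have h3 := h (a x')
    have h4 := h (a y')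
    have h5 := h (xa z)
    simp at h1 h2 h3 h4 h5
    grind
  · rintro ⟨⟨rfl, rfl⟩ | ⟨rfl, rfl⟩, rfl⟩
    · rfl
    · simp only [triple, Finset.insert_comm]

theorem isTypeB_iff (hn : 0 < n) (A : Finset (QuaternionGroup n)) :
    IsTypeB n A ↔ ∃ x y z : ZMod (2 * n), x ≠ y ∧ triple x y z = A := by
  have : NeZero (2 * n) := ⟨by omega⟩
  constructor
  · rintro ⟨i, j, k, hij, hj, -, rfl⟩
    refine ⟨i, j, k, fun h => ?_, rfl⟩
    rw [ZMod.natCast_eq_natCast_iff', Nat.mod_eq_of_lt (by omega), Nat.mod_eq_of_lt (by omega)] at h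
    omega
  · rintro ⟨x, y, z, hxy, rfl⟩
    have hv : x.val ≠ y.val := fun h => hxy (ZMod.val_injective _ h)
    have hx := x.val_lt
    have hy := y.val_lt
    have hz := z.val_lt
    rcases lt_or_gt_of_ne hv with h | h
    · exact ⟨x.val, y.val, z.val, h, by omega, by omega, by simp [triple]⟩
    · exact ⟨y.val, x.val, z.val, h, by omega, by omega, by
        simp [triple, Finset.insert_comm]⟩

/-- The number of sets of the given form satisfying `P`, in terms of the number of
admissible `y` for each `x`. -/
theorem two_mul_ncard_isTypeB_and (hn : 0 < n) {P : Finset (QuaternionGroup n) → Prop}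
    {Q : ZMod (2 * n) → ZMod (2 * n) → Prop} [NeZero (2 * n)] [DecidablePred P] [DecidableRel Q]
    (hPQ : ∀ x y z, x ≠ y → (P (triple x y z) ↔ Q x y)) {k l : ℕ}
    (hk : ∀ x : ZMod (2 * n), x + x = 0 → #{y | x ≠ y ∧ Q x y} = k)
    (hl : ∀ x : ZMod (2 * n), x + x ≠ 0 → #{y | x ≠ y ∧ Q x y} = l) :
    2 * {A : Finset (QuaternionGroup n) | IsTypeB n A ∧ P A}.ncard =
      2 * n * (2 * k + (2 * n - 2) * l) := by
  let D : Finset (ZMod (2 * n) × ZMod (2 * n)) := {p | p.1 ≠ p.2 ∧ Q p.1 p.2}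
  let f : (ZMod (2 * n) × ZMod (2 * n)) × ZMod (2 * n) → Finset (QuaternionGroup n) :=
    fun p => triple p.1.1 p.1.2 p.2
  have himage : {A : Finset (QuaternionGroup n) | IsTypeB n A ∧ P A} =
      ((D ×ˢ univ).image f : Finset _) := by
    ext A
    simp only [isTypeB_iff hn, Set.mem_ofPred_eq, coe_image, Set.mem_image, mem_coe, mem_product,
      mem_univ, and_true, Prod.exists, D, mem_filter, true_and, f]
    constructor
    · rintro ⟨⟨x, y, z, hxy, rfl⟩, hP⟩
      exact ⟨x, y, z, ⟨hxy, (hPQ x y z hxy).1 hP⟩, rfl⟩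
    · rintro ⟨x, y, z, ⟨hxy, hQ⟩, rfl⟩
      exact ⟨⟨x, y, z, hxy, rfl⟩, (hPQ x y z hxy).2 hQ⟩
  have hfiber : ∀ A ∈ (D ×ˢ univ).image f, #{p ∈ D ×ˢ univ | f p = A} = 2 := by
    intro A hA
    obtain ⟨⟨⟨x, y⟩, z⟩, hp, rfl⟩ := mem_image.1 hA
    simp only [mem_product, mem_univ, and_true, D, mem_filter, true_and] at hp
    have hQ : Q y x := by
      rw [← hPQ y x z hp.1.symm, triple_eq_triple_iff.2 ⟨Or.inr ⟨rfl, rfl⟩, rfl⟩, hPQ x y z hp.1]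
      exact hp.2
    have : ({p ∈ D ×ˢ univ | f p = f ((x, y), z)} : Finset _) = {((x, y), z), ((y, x), z)} := by
      ext ⟨⟨x', y'⟩, z'⟩
      simp only [mem_product, mem_univ, and_true, D, mem_filter, true_and, f,
        triple_eq_triple_iff, mem_insert, mem_singleton, Prod.mk.injEq]
      constructor
      · tauto
      · rintro (⟨⟨rfl, rfl⟩, rfl⟩ | ⟨⟨rfl, rfl⟩, rfl⟩)
        · exact ⟨hp, by simp⟩
        · exact ⟨⟨hp.1.symm, hQ⟩, by simp⟩
    rw [this, card_pair]
    simp [hp.1]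
  have hcard := card_eq_sum_card_image f (D ×ˢ (univ : Finset (ZMod (2 * n))))
  rw [sum_congr rfl hfiber, sum_const, smul_eq_mul, card_product, card_univ, ZMod.card] at hcard
  have htwo : #{x : ZMod (2 * n) | x + x = 0} = 2 := by
    have : ({x : ZMod (2 * n) | x + x = 0} : Finset _) = {0, (n : ZMod (2 * n))} := by
      ext x
      simp [add_self_eq_zero_iff hn]
    rw [this, card_pair (natCast_ne_zero hn).symm]
  have hrest : #{x : ZMod (2 * n) | ¬ x + x = 0} = 2 * n - 2 := by
    have := card_filter_add_card_filter_not (s := (univ : Finset (ZMod (2 * n))))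
      (fun x => x + x = 0)
    rw [card_univ, ZMod.card] at this
    omega
  have hD : #D = 2 * k + (2 * n - 2) * l := by
    have hsum : #D = ∑ x : ZMod (2 * n), #{y | x ≠ y ∧ Q x y} := by
      simp only [D, card_filter, ← univ_product_univ, sum_product]
    rw [hsum, ← sum_filter_add_sum_filter_not univ (fun x : ZMod (2 * n) => x + x = 0),
      sum_congr rfl (fun x hx => hk x (mem_filter.1 hx).2),
      sum_congr rfl (fun x hx => hl x (mem_filter.1 hx).2), sum_const, sum_const, htwo, hrest]
    simp
  rw [himage, Set.ncard_coe_finset, mul_comm, ← hcard, hD, mul_comm]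

theorem isMSTD_triple_iff (hodd : Odd n) {x y : ZMod (2 * n)} (z : ZMod (2 * n)) (hxy : x ≠ y) :
    IsMSTD (triple x y z) ↔ x + x ≠ 0 ∧ y + y ≠ 0 ∧ x + y ≠ 0 ∧ x + y ≠ n := by
  have h := natCast_add_natCast_self (n := n)
  have h0 := natCast_ne_zero hodd.pos
  have hx := add_self_ne_natCast hodd x
  rw [IsMSTD, card_triple_mul_triple_eq_ite hodd z hxy,
    card_triple_div_triple_eq_ite hodd z hxy]
  generalize (n : ZMod (2 * n)) = m at *
  split_ifs <;> grind

theorem isMDTS_triple_iff (hodd : Odd n) {x y : ZMod (2 * n)} (z : ZMod (2 * n)) (hxy : x ≠ y) :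
    IsMDTS (triple x y z) ↔ x + y = 0 := by
  have h := natCast_add_natCast_self (n := n)
  have h0 := natCast_ne_zero hodd.pos
  have hx := add_self_ne_natCast hodd x
  rw [IsMDTS, card_triple_mul_triple_eq_ite hodd z hxy,
    card_triple_div_triple_eq_ite hodd z hxy]
  generalize (n : ZMod (2 * n)) = m at *
  split_ifs <;> grind

theorem isBalanced_triple_iff (hodd : Odd n) {x y : ZMod (2 * n)} (z : ZMod (2 * n))
    (hxy : x ≠ y) :
    IsBalanced (triple x y z) ↔ x + x = 0 ∨ y + y = 0 ∨ x + y = n := by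
  have h := natCast_add_natCast_self (n := n)
  have h0 := natCast_ne_zero hodd.pos
  have hx := add_self_ne_natCast hodd x
  have hx0 := add_self_eq_zero_iff hodd.pos x
  have hy0 := add_self_eq_zero_iff hodd.pos y
  rw [IsBalanced, card_triple_mul_triple_eq_ite hodd z hxy,
    card_triple_div_triple_eq_ite hodd z hxy]
  generalize (n : ZMod (2 * n)) = m at *
  split_ifs <;> grind

end QuaternionGroup

open QuaternionGroup

theorem stmt_13 (n : ℕ) (hn : 3 ≤ n) (hodd : Odd n) :
    {A : Finset (QuaternionGroup n) | IsTypeB n A ∧ IsMSTD A}.ncard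
        = 2 * n * (n - 1) * (2 * n - 5) ∧
    {A : Finset (QuaternionGroup n) | IsTypeB n A ∧ IsMDTS A}.ncard = 2 * n * (n - 1) ∧
    {A : Finset (QuaternionGroup n) | IsTypeB n A ∧ IsBalanced A}.ncard
        = 2 * n * (5 * n - 4) := by
  classical
  have : NeZero (2 * n) := ⟨by omega⟩
  have hpos : 0 < n := by omega
  have hm := natCast_add_natCast_self (n := n)
  have hm0 := natCast_ne_zero hpos
  have hodd' := add_self_ne_natCast hodd
  have hzero := add_self_eq_zero_iff hpos
  have hcard : #(univ : Finset (ZMod (2 * n))) = 2 * n := by rw [card_univ, ZMod.card]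
  have hmstd := two_mul_ncard_isTypeB_and hpos
    (fun x y z hxy => isMSTD_triple_iff hodd z hxy) (k := 0) (l := 2 * n - 5)
    (fun x hx => by simp [hx])
    (fun x hx => by
      have : ({y | x ≠ y ∧ x + x ≠ 0 ∧ y + y ≠ 0 ∧ x + y ≠ 0 ∧ x + y ≠ n} : Finset _) =
          univ \ {0, (n : ZMod (2 * n)), x, -x, n - x} := by
        ext y
        have := hzero y
        simp
        grind
      rw [this, card_sdiff_of_subset (subset_univ _), hcard]
      have hx1 := hodd' x
      have hx0 := hzero x
      congr 1
      simp only [Finset.card_insert_eq_ite, Finset.card_singleton, mem_insert, mem_singleton]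
      generalize (n : ZMod (2 * n)) = m at *
      split_ifs <;> grind)
  have hmdts := two_mul_ncard_isTypeB_and hpos
    (fun x y z hxy => isMDTS_triple_iff hodd z hxy) (k := 0) (l := 1)
    (fun x hx => by
      rw [card_eq_zero, filter_eq_empty_iff]
      grind)
    (fun x hx => by
      rw [card_eq_one]
      refine ⟨-x, ?_⟩
      ext y
      simp
      grind)
  have hbal := two_mul_ncard_isTypeB_and hpos
    (fun x y z hxy => isBalanced_triple_iff hodd z hxy) (k := 2 * n - 1) (l := 3)
    (fun x hx => by
      have : ({y | x ≠ y ∧ (x + x = 0 ∨ y + y = 0 ∨ x + y = n)} : Finset _) =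
          univ \ {x} := by
        ext y
        simp [hx, eq_comm]
      rw [this, card_sdiff_of_subset (subset_univ _), hcard, card_singleton])
    (fun x hx => by
      rw [card_eq_three]
      have hx1 := hodd' x
      have hx0 := hzero x
      refine ⟨0, n, n - x, hm0.symm, by grind, by grind, ?_⟩
      ext y
      have := hzero y
      simp
      grind)
  obtain ⟨m, rfl⟩ : ∃ m, n = m + 3 := ⟨n - 3, by omega⟩
  have e1 : 2 * (m + 3) - 2 = 2 * (m + 2) := by omega
  have e2 : 2 * (m + 3) - 5 = 2 * m + 1 := by omega
  have e3 : 2 * (m + 3) - 1 = 2 * m + 5 := by omega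
  have e4 : m + 3 - 1 = m + 2 := by omega
  have e5 : 5 * (m + 3) - 4 = 5 * m + 11 := by omega
  rw [e1] at hmstd hmdts hbal
  rw [e2] at hmstd
  rw [e3] at hbal
  rw [e2, e4, e5]
  refine ⟨?_, ?_, ?_⟩
  · linarith
  · linarith
  · linarith
end

section
/- Let n ≥ 3 be an odd integer. Every subset of Dic_{4n} of the form D = {a^i b, a^j b, a^k b} with 0 ≤ i < j < k ≤ 2n−1 (i.e., three-element subsets disjoint from the cyclic subgroup generated by a) is balanced; in particular, among such subsets the number of MSTD subsets is 0, the number of MDTS subsets is 0, and the number of balanced subsets is 2n(n−1)(2n−1)/3. -/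
open Finset Pointwise

/-- Subsets of the form `{a^i b, a^j b, a^k b}` with `0 ≤ i < j < k ≤ 2n-1`. -/
def IsTypeD (n : ℕ) (A : Finset (QuaternionGroup n)) : Prop :=
  ∃ i j k : ℕ, i < j ∧ j < k ∧ k ≤ 2 * n - 1 ∧
    A = {QuaternionGroup.xa (i : ZMod (2 * n)), QuaternionGroup.xa (j : ZMod (2 * n)),
         QuaternionGroup.xa (k : ZMod (2 * n))}

theorem QuaternionGroup.inv_xa {n : ℕ} (i : ZMod (2 * n)) :
    (xa i)⁻¹ = xa ((n : ZMod (2 * n)) + i) :=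
  rfl

theorem QuaternionGroup.xa_mul_xa_eq_a_mul_div {n : ℕ} (i j : ZMod (2 * n)) :
    xa i * xa j = a (n : ZMod (2 * n)) * (xa i / xa j) := by
  have h : (2 * n : ZMod (2 * n)) = 0 := by exact_mod_cast ZMod.natCast_self (2 * n)
  simp only [div_eq_mul_inv, inv_xa, xa_mul_xa, a_mul_a]
  congr 1
  linear_combination -h

/-- Any finite set of elements outside the cyclic subgroup is balanced, because its sumset is a
translate of its difference set. -/
theorem isBalanced_of_forall_exists_xa {n : ℕ} {A : Finset (QuaternionGroup n)}
    (hA : ∀ x ∈ A, ∃ i, x = QuaternionGroup.xa i) : IsBalanced A := by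
  have h : A * A = (A / A).image (QuaternionGroup.a (n : ZMod (2 * n)) * ·) := by
    rw [Finset.mul_def, Finset.div_def, Finset.image_image]
    refine Finset.image_congr fun p hp => ?_
    obtain ⟨hp₁, hp₂⟩ := Finset.mem_product.1 (Finset.mem_coe.1 hp)
    obtain ⟨i, hi⟩ := hA _ hp₁
    obtain ⟨j, hj⟩ := hA _ hp₂
    simp only [Function.comp_apply, hi, hj, QuaternionGroup.xa_mul_xa_eq_a_mul_div]
  rw [IsBalanced, h, Finset.card_image_of_injective _ (mul_right_injective _)]

theorem IsTypeD.isBalanced {n : ℕ} {A : Finset (QuaternionGroup n)} (hA : IsTypeD n A) :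
    IsBalanced A := by
  obtain ⟨i, j, k, -, -, -, rfl⟩ := hA
  apply isBalanced_of_forall_exists_xa
  simp only [Finset.mem_insert, Finset.mem_singleton]
  rintro x (rfl | rfl | rfl) <;> exact ⟨_, rfl⟩

theorem Finset.exists_lt_lt_of_card_eq_three {α : Type*} [LinearOrder α] {s : Finset α}
    (hs : s.card = 3) : ∃ i j k, i < j ∧ j < k ∧ s = {i, j, k} := by
  let f := s.orderEmbOfFin hs
  refine ⟨f 0, f 1, f 2, f.strictMono (by decide), f.strictMono (by decide), ?_⟩
  rw [← Finset.image_orderEmbOfFin_univ s hs,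
    show (Finset.univ : Finset (Fin 3)) = {0, 1, 2} by decide]
  simp only [Finset.image_insert, Finset.image_singleton, f]

theorem QuaternionGroup.injOn_xa_natCast (n : ℕ) :
    Set.InjOn (fun i : ℕ => (xa (i : ZMod (2 * n)) : QuaternionGroup n))
      (Finset.range (2 * n)) := by
  intro i hi j hj h
  rw [Finset.mem_coe, Finset.mem_range] at hi hj
  rw [xa.injEq, ZMod.natCast_eq_natCast_iff'] at h
  rwa [Nat.mod_eq_of_lt hi, Nat.mod_eq_of_lt hj] at h

theorem isTypeD_iff_exists_mem_powersetCard {n : ℕ} (hn : 0 < n)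
    {A : Finset (QuaternionGroup n)} :
    IsTypeD n A ↔ ∃ s ∈ Finset.powersetCard 3 (Finset.range (2 * n)),
      s.image (fun i : ℕ => QuaternionGroup.xa (i : ZMod (2 * n))) = A := by
  constructor
  · rintro ⟨i, j, k, hij, hjk, hk, rfl⟩
    refine ⟨{i, j, k}, Finset.mem_powersetCard.2 ⟨?_, ?_⟩, by simp [Finset.image_insert]⟩
    · intro x
      simp only [Finset.mem_insert, Finset.mem_singleton, Finset.mem_range]
      omega
    · exact Finset.card_eq_three.2 ⟨i, j, k, hij.ne, (hij.trans hjk).ne, hjk.ne, rfl⟩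
  · rintro ⟨s, hs, rfl⟩
    obtain ⟨hsub, hcard⟩ := Finset.mem_powersetCard.1 hs
    obtain ⟨i, j, k, hij, hjk, rfl⟩ := Finset.exists_lt_lt_of_card_eq_three hcard
    have hk : k < 2 * n := Finset.mem_range.1 (hsub (by simp))
    exact ⟨i, j, k, hij, hjk, by omega, by simp [Finset.image_insert]⟩

theorem ncard_setOf_isTypeD {n : ℕ} (hn : 0 < n) :
    {A : Finset (QuaternionGroup n) | IsTypeD n A}.ncard = (2 * n).choose 3 := by
  have h : {A : Finset (QuaternionGroup n) | IsTypeD n A} =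
      Finset.image (fun i : ℕ => (QuaternionGroup.xa (i : ZMod (2 * n)) : QuaternionGroup n)) ''
        (Finset.powersetCard 3 (Finset.range (2 * n)) : Set (Finset ℕ)) := by
    ext A
    exact isTypeD_iff_exists_mem_powersetCard hn
  rw [h, Set.InjOn.ncard_image, Set.ncard_coe_finset, Finset.card_powersetCard,
    Finset.card_range]
  refine (Finset.image_injOn_powerset_of_injOn (QuaternionGroup.injOn_xa_natCast n)).mono ?_
  exact fun s hs => Finset.mem_powerset.2 (Finset.mem_powersetCard.1 hs).1

theorem Nat.choose_two_mul_three (n : ℕ) :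
    (2 * n).choose 3 = 2 * n * (n - 1) * (2 * n - 1) / 3 := by
  have h := Nat.descFactorial_eq_factorial_mul_choose (2 * n) 3
  simp only [Nat.descFactorial_succ, Nat.descFactorial_zero, Nat.factorial, Nat.succ_eq_add_one,
    Nat.sub_zero, show 2 * n - 2 = 2 * (n - 1) by omega] at h
  refine (Nat.div_eq_of_eq_mul_right (by norm_num) ?_).symm
  linarith

theorem stmt_15 (n : ℕ) (hn : 3 ≤ n) (hodd : Odd n) :
    (∀ A : Finset (QuaternionGroup n), IsTypeD n A → IsBalanced A) ∧
    {A : Finset (QuaternionGroup n) | IsTypeD n A ∧ IsMSTD A}.ncard = 0 ∧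
    {A : Finset (QuaternionGroup n) | IsTypeD n A ∧ IsMDTS A}.ncard = 0 ∧
    {A : Finset (QuaternionGroup n) | IsTypeD n A ∧ IsBalanced A}.ncard
        = 2 * n * (n - 1) * (2 * n - 1) / 3 := by
  refine ⟨fun A hA => hA.isBalanced, ?_, ?_, ?_⟩
  · convert Set.ncard_empty (Finset (QuaternionGroup n))
    exact Set.eq_empty_of_forall_notMem fun A hA => hA.2.ne hA.1.isBalanced.symm
  · convert Set.ncard_empty (Finset (QuaternionGroup n))
    exact Set.eq_empty_of_forall_notMem fun A hA => hA.2.ne hA.1.isBalanced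
  · rw [← Nat.choose_two_mul_three, ← ncard_setOf_isTypeD (by omega : 0 < n)]
    congr 1
    ext A
    exact and_iff_left_of_imp IsTypeD.isBalanced
end

section
/- Let n ≥ 6 be an odd integer (so n ≥ 7). Consider subsets of Dic_{4n} of the form A = R ∪ Sb, where R = {a^r, a^{r+1}, ..., a^{r+n−1}} for some integer 0 ≤ r ≤ n and Sb = {a^{i₁}b, a^{i₂}b, ..., a^{iₙ}b} for some n distinct exponents 0 ≤ i₁, ..., iₙ ≤ 2n−1 (so |A| = 2n). Then: the number of such subsets that are MSTD is at least (n+1)(7·2^{n−3} − 4); the number of such subsets that are MDTS is exactly 0; and the number of such subsets that are balanced is at least C(2n, n)·(n+1) − 2^n·(n+1). -/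
open Finset Pointwise

/-- Subsets of the form `A = R ∪ Sb` where `R = {a^r, a^(r+1), …, a^(r+n-1)}` for some
`0 ≤ r ≤ n` and `Sb = {a^(i₁) b, …, a^(iₙ) b}` for `n` distinct exponents, i.e. a set
`S ⊆ ℤ/2nℤ` with `|S| = n`. -/
def IsTypeRS (n : ℕ) (A : Finset (QuaternionGroup n)) : Prop :=
  ∃ r : ℕ, r ≤ n ∧ ∃ S : Finset (ZMod (2 * n)), S.card = n ∧
    A = (Finset.range n).image (fun t => QuaternionGroup.a ((r + t : ℕ) : ZMod (2 * n)))
        ∪ S.image QuaternionGroup.xa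

namespace QuaternionGroup

variable {n : ℕ}

theorem natCast_add_self_eq_zero (n : ℕ) : (n : ZMod (2 * n)) + n = 0 := by
  have := ZMod.natCast_self (2 * n)
  push_cast at this
  rw [← two_mul]; exact_mod_cast this

@[simp]
theorem a_inv (i : ZMod (2 * n)) : (a i)⁻¹ = a (-i) := rfl

@[simp]
theorem xa_inv (i : ZMod (2 * n)) : (xa i)⁻¹ = xa ((n : ZMod (2 * n)) + i) := rfl

/-- The set `{a^r, …, a^(r+n-1)}` together with the elements `xa s` for `s ∈ S`. -/
def arcUnion (n r : ℕ) (S : Finset (ZMod (2 * n))) : Finset (QuaternionGroup n) :=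
  (range n).image (fun t => a ((r + t : ℕ) : ZMod (2 * n))) ∪ S.image xa

theorem xa_mem_arcUnion {r : ℕ} {S : Finset (ZMod (2 * n))} {z : ZMod (2 * n)} :
    xa z ∈ arcUnion n r S ↔ z ∈ S := by
  simp [arcUnion]

variable [NeZero n]

/-- The residues `0, 1, …, n - 1` modulo `2 * n`. -/
def halfArc (n : ℕ) [NeZero n] : Finset (ZMod (2 * n)) := {z | z.val < n}

theorem mem_halfArc {z : ZMod (2 * n)} : z ∈ halfArc n ↔ z.val < n := by simp [halfArc]

theorem natCast_mem_halfArc {t : ℕ} (ht : t < n) : (t : ZMod (2 * n)) ∈ halfArc n := by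
  rw [mem_halfArc, ZMod.val_natCast, Nat.mod_eq_of_lt (by omega)]
  exact ht

theorem card_halfArc : (halfArc n).card = n := by
  have : halfArc n = (range n).image (fun t : ℕ => (t : ZMod (2 * n))) := by
    ext z
    simp only [mem_image, mem_range]
    refine ⟨fun hz => ⟨z.val, mem_halfArc.1 hz, ZMod.natCast_zmod_val z⟩, ?_⟩
    rintro ⟨t, ht, rfl⟩
    exact natCast_mem_halfArc ht
  rw [this, card_image_of_injOn, card_range]
  intro s hs t ht h
  simp only [coe_range, Set.mem_Iio] at hs ht
  have := congrArg ZMod.val h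
  simpa only [ZMod.val_natCast, Nat.mod_eq_of_lt (show s < 2 * n by omega),
    Nat.mod_eq_of_lt (show t < 2 * n by omega)] using this

theorem add_mem_halfArc_iff (z : ZMod (2 * n)) : z + n ∈ halfArc n ↔ z ∉ halfArc n := by
  have hn := NeZero.pos n
  have hz := ZMod.val_lt z
  rw [mem_halfArc, mem_halfArc, ZMod.val_add, ZMod.val_natCast,
    Nat.mod_eq_of_lt (show n < 2 * n by omega)]
  by_cases h : z.val < n
  · rw [Nat.mod_eq_of_lt (by omega)]; omega
  · rw [Nat.mod_eq_sub_mod (by omega), Nat.mod_eq_of_lt (by omega)]; omega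

theorem eq_zero_of_sub_one_not_mem {c : ZMod (2 * n)} (h : c ∈ halfArc n)
    (h' : c - 1 ∉ halfArc n) : c = 0 := by
  by_contra hc
  have hpos : c.val ≠ 0 := fun h0 => hc ((ZMod.val_eq_zero c).1 h0)
  rw [mem_halfArc] at h
  apply h'
  have : c - 1 = ((c.val - 1 : ℕ) : ZMod (2 * n)) := by
    rw [Nat.cast_sub (by omega), ZMod.natCast_zmod_val, Nat.cast_one]
  rw [this]
  exact natCast_mem_halfArc (by omega)

theorem natCast_sub_one_mem_halfArc : (n : ZMod (2 * n)) - 1 ∈ halfArc n := by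
  have hn := NeZero.pos n
  have : (n : ZMod (2 * n)) - 1 = ((n - 1 : ℕ) : ZMod (2 * n)) := by
    rw [Nat.cast_sub (by omega), Nat.cast_one]
  rw [this]
  exact natCast_mem_halfArc (by omega)

theorem zero_mem_halfArc : (0 : ZMod (2 * n)) ∈ halfArc n := by
  simp [mem_halfArc, NeZero.pos n]

theorem eq_zero_of_add_mem_halfArc {c : ZMod (2 * n)}
    (h : ∀ z ∈ halfArc n, z + c ∈ halfArc n) : c = 0 := by
  refine eq_zero_of_sub_one_not_mem (by simpa using h 0 zero_mem_halfArc) ?_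
  rw [← add_mem_halfArc_iff]
  convert h _ natCast_sub_one_mem_halfArc using 1
  ring

/-- If an injection of `ZMod (2 * n)` maps an `n`-subset into the complement of another one, then
it maps it onto that complement. -/
theorem mem_iff_not_mem_of_injective {X Y : Finset (ZMod (2 * n))} (hX : X.card = n)
    (hY : Y.card = n) {e : ZMod (2 * n) → ZMod (2 * n)} (he : Function.Injective e)
    (h : ∀ z ∈ X, e z ∉ Y) (z : ZMod (2 * n)) : z ∈ X ↔ e z ∉ Y := by
  refine ⟨h z, fun hz => ?_⟩
  have hsub : X.image e ⊆ Yᶜ := by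
    intro w hw
    obtain ⟨v, hv, rfl⟩ := mem_image.1 hw
    exact mem_compl.2 (h v hv)
  have heq : X.image e = Yᶜ := by
    refine eq_of_subset_of_card_le hsub ?_
    rw [card_image_of_injective _ he, card_compl, ZMod.card]
    omega
  have : e z ∈ X.image e := heq ▸ mem_compl.2 hz
  obtain ⟨v, hv, hvz⟩ := mem_image.1 this
  exact he hvz ▸ hv

/-- The sets containing exactly one element of each pair `{z, z + n}`. -/
def transversals (n : ℕ) [NeZero n] : Finset (Finset (ZMod (2 * n))) :=
  {S | ∀ z, z ∈ S ↔ z + n ∉ S}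

theorem mem_transversals {S : Finset (ZMod (2 * n))} :
    S ∈ transversals n ↔ ∀ z, z ∈ S ↔ z + n ∉ S := by simp [transversals]

theorem card_of_mem_transversals {S : Finset (ZMod (2 * n))} (hS : S ∈ transversals n) :
    S.card = n := by
  rw [mem_transversals] at hS
  have h : S.image (· + (n : ZMod (2 * n))) = Sᶜ := by
    ext z
    rw [mem_compl, mem_image]
    constructor
    · rintro ⟨w, hw, rfl⟩
      exact (hS w).1 hw
    · intro hz
      refine ⟨z + n, ?_, by rw [add_assoc, natCast_add_self_eq_zero, add_zero]⟩
      by_contra hzn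
      exact hz ((hS z).2 hzn)
  have := congrArg Finset.card h
  rw [card_image_of_injective _ (add_left_injective _), card_compl, ZMod.card] at this
  have := card_le_univ S
  rw [ZMod.card] at this
  omega

theorem card_transversals : (transversals n).card = 2 ^ n := by
  have hnn (z : ZMod (2 * n)) : z + n + n = z := by
    rw [add_assoc, natCast_add_self_eq_zero, add_zero]
  have hpow : (halfArc n).powerset.card = 2 ^ n := by rw [card_powerset, card_halfArc]
  rw [← hpow]
  refine card_nbij' (fun S => S ∩ halfArc n)
    (fun U => univ.filter fun z => if z ∈ halfArc n then z ∈ U else z + n ∉ U) ?_ ?_ ?_ ?_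
  · intro S _
    simp
  · intro U _
    simp only [SetLike.mem_coe, mem_transversals, mem_filter, mem_univ, true_and,
      add_mem_halfArc_iff, hnn]
    intro z
    by_cases hz : z ∈ halfArc n <;> simp [hz]
  · intro S hS
    simp only [SetLike.mem_coe, mem_transversals] at hS
    ext z
    have hz := hS z
    have hz' := add_mem_halfArc_iff z
    simp only [mem_filter, mem_univ, true_and, mem_inter]
    split_ifs <;> tauto
  · intro U hU
    simp only [SetLike.mem_coe, mem_powerset] at hU
    ext z
    have hz := @hU z
    simp only [mem_filter, mem_univ, true_and, mem_inter]
    split_ifs <;> tauto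

theorem exists_mem_add_mem {S : Finset (ZMod (2 * n))} (hS : S.card = n)
    (hT : S ∉ transversals n) : ∃ s ∈ S, s + (n : ZMod (2 * n)) ∈ S := by
  by_contra! h
  exact hT (mem_transversals.2 (mem_iff_not_mem_of_injective hS hS (add_left_injective _) h))

/-- For odd `n`, even differences always occur in an `n`-subset of `ZMod (2 * n)`. -/
theorem exists_mem_add_two_mul_mem (hodd : Odd n) {S : Finset (ZMod (2 * n))} (hS : S.card = n)
    (m : ZMod (2 * n)) : ∃ s ∈ S, s + 2 * m ∈ S := by
  by_contra! h
  have key := mem_iff_not_mem_of_injective hS hS (add_left_injective (2 * m)) h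
  obtain ⟨s, hs⟩ : S.Nonempty := card_pos.1 (by rw [hS]; exact NeZero.pos n)
  have hk (k : ℕ) : s + k * (2 * m) ∈ S ↔ Even k := by
    induction k with
    | zero => simpa using hs
    | succ k ih =>
      rw [Nat.even_add_one, ← ih, key (s + k * (2 * m)), not_not]
      push_cast
      ring_nf
  have h0 : (n : ZMod (2 * n)) * (2 * m) = 0 := by
    linear_combination m * natCast_add_self_eq_zero n
  have := (hk n).1 (by simpa [h0] using hs)
  exact (Nat.not_even_iff_odd.2 hodd) this

theorem a_mem_arcUnion {r : ℕ} {S : Finset (ZMod (2 * n))} {z : ZMod (2 * n)} :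
    a z ∈ arcUnion n r S ↔ z - r ∈ halfArc n := by
  simp only [arcUnion, mem_union, mem_image, mem_range, a.injEq, reduceCtorEq, and_false,
    exists_false, or_false]
  constructor
  · rintro ⟨t, ht, rfl⟩
    simpa using natCast_mem_halfArc ht
  · intro hz
    exact ⟨(z - r).val, mem_halfArc.1 hz, by simp⟩

theorem arcUnion_injective {r r' : ℕ} (hr : r ≤ n) (hr' : r' ≤ n) {S S' : Finset (ZMod (2 * n))}
    (h : arcUnion n r S = arcUnion n r' S') : r = r' ∧ S = S' := by
  have hn := NeZero.pos n
  constructor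
  · have h0 : (r : ZMod (2 * n)) - r' = 0 := by
      apply eq_zero_of_add_mem_halfArc
      intro z hz
      have : a (z + (r : ZMod (2 * n))) ∈ arcUnion n r S := a_mem_arcUnion.2 (by simpa using hz)
      rw [h, a_mem_arcUnion] at this
      rwa [← add_sub_assoc]
    have := congrArg ZMod.val (sub_eq_zero.1 h0)
    simpa only [ZMod.val_natCast, Nat.mod_eq_of_lt (show r < 2 * n by omega),
      Nat.mod_eq_of_lt (show r' < 2 * n by omega)] using this
  · ext z
    rw [← xa_mem_arcUnion (r := r), h, xa_mem_arcUnion]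

variable {r : ℕ} {S : Finset (ZMod (2 * n))}

theorem a_mem_mul_arcUnion (hodd : Odd n) (hS : S.card = n) (d : ZMod (2 * n)) :
    a d ∈ arcUnion n r S * arcUnion n r S := by
  by_contra hd
  have hR (z : ZMod (2 * n)) (hz : z ∈ halfArc n) : d - 2 * r - z ∉ halfArc n := by
    intro hz'
    apply hd
    have := mul_mem_mul (a_mem_arcUnion (S := S) (r := r) (z := z + r) |>.2 (by simpa using hz))
      (a_mem_arcUnion (S := S) (r := r) (z := d - r - z) |>.2 (by convert hz' using 1; ring))
    rw [a_mul_a] at this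
    convert this using 2
    ring
  have h0 : d - 2 * r + 1 = 0 := by
    apply eq_zero_of_sub_one_not_mem
    · have := hR _ natCast_sub_one_mem_halfArc
      rw [← add_mem_halfArc_iff] at this
      convert this using 1
      ring
    · simpa using hR 0 zero_mem_halfArc
  obtain ⟨k, hk⟩ := hodd
  have hk' : (n : ZMod (2 * n)) = 2 * k + 1 := by
    exact_mod_cast congrArg (Nat.cast : ℕ → ZMod (2 * n)) hk
  obtain ⟨s, hs, hs'⟩ := exists_mem_add_two_mul_mem ⟨k, hk⟩ hS (r - k - 1)
  apply hd
  have := mul_mem_mul ((xa_mem_arcUnion (r := r)).2 hs) ((xa_mem_arcUnion (r := r)).2 hs')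
  rw [xa_mul_xa] at this
  convert this using 2
  linear_combination h0 - hk'

theorem mem_iff_of_xa_not_mem_mul (hS : S.card = n) {x : ZMod (2 * n)}
    (hx : xa x ∉ arcUnion n r S * arcUnion n r S) (z : ZMod (2 * n)) :
    (z ∈ halfArc n ↔ x - (z + r) ∉ S) ∧ (z ∈ halfArc n ↔ x + (z + r) ∉ S) := by
  constructor
  · refine mem_iff_not_mem_of_injective card_halfArc hS (e := fun z => x - (z + r)) ?_ ?_ z
    · exact fun u v huv => by simpa using huv
    · intro z hz hzS
      apply hx
      have := mul_mem_mul ((xa_mem_arcUnion (r := r)).2 hzS)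
        (a_mem_arcUnion (S := S) (r := r) (z := z + r) |>.2 (by simpa using hz))
      simpa using this
  · refine mem_iff_not_mem_of_injective card_halfArc hS (e := fun z => x + (z + r)) ?_ ?_ z
    · exact fun u v huv => by simpa using huv
    · intro z hz hzS
      apply hx
      have := mul_mem_mul
        (a_mem_arcUnion (S := S) (r := r) (z := z + r) |>.2 (by simpa using hz))
        ((xa_mem_arcUnion (r := r)).2 hzS)
      simpa using this

theorem mem_transversals_of_xa_not_mem_mul (hS : S.card = n) {x : ZMod (2 * n)}
    (hx : xa x ∉ arcUnion n r S * arcUnion n r S) : S ∈ transversals n := by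
  rw [mem_transversals]
  intro y
  have h1 := (mem_iff_of_xa_not_mem_mul hS hx (y - x - r)).2
  have h2 := (mem_iff_of_xa_not_mem_mul hS hx (y - x - r + n)).2
  rw [add_mem_halfArc_iff] at h2
  have e1 : x + (y - x - r + r) = y := by ring
  have e2 : x + (y - x - r + n + r) = y + n := by ring
  rw [e1] at h1
  rw [e2] at h2
  tauto

theorem two_mul_eq_of_xa_not_mem_mul (hn : 1 < n) (hr : r ≤ n) (hS : S.card = n) {x : ZMod (2 * n)}
    (hx : xa x ∉ arcUnion n r S * arcUnion n r S) : 2 * r = n + 1 := by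
  have hnn := natCast_add_self_eq_zero n
  have hsymm (z : ZMod (2 * n)) : z ∈ halfArc n ↔ -z - 2 * r ∈ halfArc n := by
    rw [(mem_iff_of_xa_not_mem_mul hS hx z).1, (mem_iff_of_xa_not_mem_mul hS hx (-z - 2 * r)).2]
    ring_nf
  have h0 : (n : ZMod (2 * n)) + 1 - 2 * r = 0 := by
    apply eq_zero_of_sub_one_not_mem
    · have := (hsymm _).1 natCast_sub_one_mem_halfArc
      convert this using 1
      linear_combination hnn
    · have h1 := (hsymm 0).1 zero_mem_halfArc
      have h2 := add_mem_halfArc_iff (-0 - 2 * r : ZMod (2 * n))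
      have e : (n : ZMod (2 * n)) + 1 - 2 * r - 1 = -0 - 2 * r + n := by ring
      rw [e]
      tauto
  have h1 : ((n + 1 : ℕ) : ZMod (2 * n)) = ((2 * r : ℕ) : ZMod (2 * n)) := by
    push_cast
    exact sub_eq_zero.1 h0
  have h2 := (Nat.modEq_iff_dvd.1 ((ZMod.natCast_eq_natCast_iff _ _ _).1 h1))
  obtain ⟨k, hk⟩ := h2
  push_cast at hk
  have hk1 : k < 1 := by
    by_contra! hk1
    nlinarith
  have hk2 : -1 < k := by
    by_contra! hk2
    nlinarith
  obtain rfl : k = 0 := by omega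
  omega

theorem mul_arcUnion_eq_univ (hn : 1 < n) (hodd : Odd n) (hr : r ≤ n) (hS : S.card = n)
    (h : S ∉ transversals n ∨ 2 * r ≠ n + 1) : arcUnion n r S * arcUnion n r S = univ := by
  rw [eq_univ_iff_forall]
  rintro (d | x)
  · exact a_mem_mul_arcUnion hodd hS d
  · by_contra hx
    exact h.elim (· (mem_transversals_of_xa_not_mem_mul hS hx))
      (· (two_mul_eq_of_xa_not_mem_mul hn hr hS hx))

theorem le_card_mul_arcUnion (hodd : Odd n) (hS : S.card = n) :
    4 * n ≤ (arcUnion n r S * arcUnion n r S).card + 1 := by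
  rw [← QuaternionGroup.card (n := n), ← card_add_card_compl (arcUnion n r S * arcUnion n r S)]
  gcongr
  rw [card_le_one]
  rintro (d | x) hx (d' | x') hx'
  · exact absurd (a_mem_mul_arcUnion hodd hS d) (mem_compl.1 hx)
  · exact absurd (a_mem_mul_arcUnion hodd hS d) (mem_compl.1 hx)
  · exact absurd (a_mem_mul_arcUnion hodd hS d') (mem_compl.1 hx')
  · rw [mem_compl] at hx hx'
    congr 1
    refine (sub_eq_zero.1 (eq_zero_of_add_mem_halfArc fun z hz => ?_))
    rw [(mem_iff_of_xa_not_mem_mul hS hx z).2] at hz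
    rw [(mem_iff_of_xa_not_mem_mul hS hx' _).2]
    convert hz using 2
    ring

theorem card_div_arcUnion_lt (hS : S ∈ transversals n) :
    (arcUnion n r S / arcUnion n r S).card < 4 * n := by
  rw [← QuaternionGroup.card (n := n), card_lt_iff_ne_univ]
  intro h
  have hn : a (n : ZMod (2 * n)) ∈ arcUnion n r S / arcUnion n r S := h ▸ mem_univ _
  have hnn := natCast_add_self_eq_zero n
  rw [mem_div] at hn
  obtain ⟨i | i, hi, j | j, hj, hij⟩ := hn
  · rw [a_mem_arcUnion] at hi hj
    simp only [div_eq_mul_inv, a_inv, a_mul_a, a.injEq] at hij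
    rw [show i - r = j - r + n by linear_combination hij, add_mem_halfArc_iff] at hi
    exact hi hj
  · simp [div_eq_mul_inv] at hij
  · simp [div_eq_mul_inv] at hij
  · rw [xa_mem_arcUnion] at hi hj
    simp only [div_eq_mul_inv, xa_inv, xa_mul_xa, a.injEq] at hij
    rw [show j = i + n by linear_combination hij - hnn] at hj
    exact (mem_transversals.1 hS i).1 hi hj

theorem div_arcUnion_eq_univ (hS : S.card = n) (hT : S ∉ transversals n) :
    arcUnion n r S / arcUnion n r S = univ := by
  have hnn := natCast_add_self_eq_zero n
  rw [eq_univ_iff_forall]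
  rintro (d | x)
  · by_contra hd
    have h0 : d + n = 0 := by
      apply eq_zero_of_add_mem_halfArc
      intro z hz
      rw [← add_assoc, add_mem_halfArc_iff]
      intro hz'
      apply hd
      have := div_mem_div
        (a_mem_arcUnion (S := S) (r := r) (z := z + d + r) |>.2 (by simpa using hz'))
        (a_mem_arcUnion (S := S) (r := r) (z := z + r) |>.2 (by simpa using hz))
      rw [div_eq_mul_inv (_ : QuaternionGroup n), a_inv, a_mul_a] at this
      convert this using 2
      ring
    obtain ⟨s, hs, hs'⟩ := exists_mem_add_mem hS hT
    apply hd
    have := div_mem_div ((xa_mem_arcUnion (r := r)).2 hs) ((xa_mem_arcUnion (r := r)).2 hs')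
    rw [div_eq_mul_inv (_ : QuaternionGroup n), xa_inv, xa_mul_xa] at this
    convert this using 2
    linear_combination h0 - 2 * hnn
  · obtain ⟨s, hs⟩ : S.Nonempty := card_pos.1 (by rw [hS]; exact NeZero.pos n)
    by_cases h : s - x - r ∈ halfArc n
    · have := div_mem_div ((xa_mem_arcUnion (r := r)).2 hs) (a_mem_arcUnion (S := S).2 h)
      rw [div_eq_mul_inv (_ : QuaternionGroup n), a_inv, xa_mul_a] at this
      convert this using 2
      ring
    · rw [← add_mem_halfArc_iff] at h
      have := div_mem_div
        (a_mem_arcUnion (S := S) (r := r) (z := s - x + n) |>.2 (by convert h using 1; ring))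
        ((xa_mem_arcUnion (r := r)).2 hs)
      rw [div_eq_mul_inv (_ : QuaternionGroup n), xa_inv, a_mul_xa] at this
      convert this using 2
      ring

theorem card_mul_le_ncard_of_arcUnion {P : Finset (QuaternionGroup n) → Prop} {I : Finset ℕ}
    {F : Finset (Finset (ZMod (2 * n)))} (hI : ∀ r ∈ I, r ≤ n) (hF : ∀ S ∈ F, S.card = n)
    (hP : ∀ r ∈ I, ∀ S ∈ F, P (arcUnion n r S)) :
    I.card * F.card ≤ {A : Finset (QuaternionGroup n) | IsTypeRS n A ∧ P A}.ncard := by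
  rw [← card_product, ← card_image_of_injOn (s := I ×ˢ F) (f := fun p => arcUnion n p.1 p.2),
    ← Set.ncard_coe_finset]
  · refine Set.ncard_le_ncard ?_ (Set.toFinite _)
    intro A hA
    simp only [coe_image, Set.mem_image, mem_coe, mem_product] at hA
    obtain ⟨⟨r, S⟩, ⟨hr, hS⟩, rfl⟩ := hA
    exact ⟨⟨r, hI r hr, S, hF S hS, rfl⟩, hP r hr S hS⟩
  · rintro ⟨r, S⟩ h ⟨r', S'⟩ h' heq
    simp only [coe_product, Set.mem_prod, mem_coe] at h h'
    obtain ⟨rfl, rfl⟩ := arcUnion_injective (hI _ h.1) (hI _ h'.1) heq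
    rfl

theorem card_mul_two_pow_le_ncard_isMSTD (hn : 1 < n) (hodd : Odd n) :
    n * 2 ^ n ≤ {A : Finset (QuaternionGroup n) | IsTypeRS n A ∧ IsMSTD A}.ncard := by
  obtain ⟨k, hk⟩ := hodd
  have hI : ((range (n + 1)).erase (k + 1)).card = n := by
    rw [card_erase_of_mem (by simp; omega)]
    simp
  rw [← card_transversals]
  conv_lhs => enter [1]; rw [← hI]
  refine card_mul_le_ncard_of_arcUnion ?_ (fun S => card_of_mem_transversals) ?_
  · intro r hr
    simp only [mem_erase, mem_range] at hr
    omega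
  · intro r hr S hS
    simp only [mem_erase, mem_range] at hr
    rw [IsMSTD, mul_arcUnion_eq_univ hn ⟨k, hk⟩ (by omega) (card_of_mem_transversals hS)
      (Or.inr (by omega)), card_univ, QuaternionGroup.card]
    exact card_div_arcUnion_lt hS

theorem not_isMDTS_of_isTypeRS (hn : 1 < n) (hodd : Odd n) {A : Finset (QuaternionGroup n)}
    (hA : IsTypeRS n A) : ¬ IsMDTS A := by
  obtain ⟨r, hr, S, hS, rfl⟩ := hA
  change ¬ IsMDTS (arcUnion n r S)
  rw [IsMDTS, not_lt]
  by_cases hT : S ∈ transversals n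
  · have := card_div_arcUnion_lt (r := r) hT
    have := le_card_mul_arcUnion (r := r) hodd hS
    omega
  · rw [mul_arcUnion_eq_univ hn hodd hr hS (Or.inl hT)]
    exact card_le_univ _

theorem choose_mul_le_ncard_isBalanced (hn : 1 < n) (hodd : Odd n) :
    (2 * n).choose n * (n + 1) - 2 ^ n * (n + 1) ≤
      {A : Finset (QuaternionGroup n) | IsTypeRS n A ∧ IsBalanced A}.ncard := by
  have hF : (powersetCard n (univ : Finset (ZMod (2 * n))) \ transversals n).card =
      (2 * n).choose n - 2 ^ n := by
    rw [card_sdiff_of_subset, card_powersetCard, card_univ, ZMod.card, card_transversals]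
    intro S hS
    simpa using card_of_mem_transversals hS
  rw [← Nat.sub_mul, ← hF, mul_comm]
  conv_lhs => enter [1]; rw [← card_range (n + 1)]
  refine card_mul_le_ncard_of_arcUnion ?_ ?_ ?_
  · intro r hr
    simp only [mem_range] at hr
    omega
  · intro S hS
    exact (mem_powersetCard.1 (mem_sdiff.1 hS).1).2
  · intro r hr S hS
    simp only [mem_range, mem_sdiff, mem_powersetCard, subset_univ, true_and] at hr hS
    rw [IsBalanced, mul_arcUnion_eq_univ hn hodd (by omega) hS.1 (Or.inl hS.2),
      div_arcUnion_eq_univ hS.1 hS.2]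

end QuaternionGroup

theorem stmt_17 (n : ℕ) (hn : 6 ≤ n) (hodd : Odd n) :
    (n + 1) * (7 * 2 ^ (n - 3) - 4) ≤
        {A : Finset (QuaternionGroup n) | IsTypeRS n A ∧ IsMSTD A}.ncard ∧
    {A : Finset (QuaternionGroup n) | IsTypeRS n A ∧ IsMDTS A}.ncard = 0 ∧
    (2 * n).choose n * (n + 1) - 2 ^ n * (n + 1) ≤
        {A : Finset (QuaternionGroup n) | IsTypeRS n A ∧ IsBalanced A}.ncard := by
  have : NeZero n := ⟨by omega⟩
  refine ⟨le_trans ?_ (QuaternionGroup.card_mul_two_pow_le_ncard_isMSTD (by omega) hodd), ?_,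
    QuaternionGroup.choose_mul_le_ncard_isBalanced (by omega) hodd⟩
  · have h7 : 7 ≤ n := by
      obtain ⟨k, rfl⟩ := hodd
      omega
    have h2 : 2 ^ n = 8 * 2 ^ (n - 3) := by
      rw [show (8 : ℕ) = 2 ^ 3 by norm_num, ← pow_add]
      congr 1
      omega
    calc (n + 1) * (7 * 2 ^ (n - 3) - 4) ≤ (n + 1) * (7 * 2 ^ (n - 3)) := by gcongr; omega
      _ = (7 * (n + 1)) * 2 ^ (n - 3) := by ring
      _ ≤ (8 * n) * 2 ^ (n - 3) := by gcongr ?_ * _; omega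
      _ = n * 2 ^ n := by rw [h2]; ring
  · rw [Set.ncard_eq_zero (Set.toFinite _), Set.eq_empty_iff_forall_notMem]
    exact fun A hA => QuaternionGroup.not_isMDTS_of_isTypeRS (by omega) hodd hA.1 hA.2
end
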